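/- arXiv:1404.6818 — 2 statements merged into one kernel-verified Lean document; each statement's English description precedes it below -/
import Mathlib

section
/- Let S_k and S_ℓ be subspaces of ℝ^m of dimensions d_k and d_ℓ with orthonormal bases U^{(k)} ∈ ℝ^{m×d_k} and U^{(ℓ)} ∈ ℝ^{m×d_ℓ}, let Φ ∈ ℝ^{p×m} be any matrix, and set V^{(k)} = Φ U^{(k)}, V^{(ℓ)} = Φ U^{(ℓ)}. Then (1/√(min(d_k, d_ℓ))) ‖(V^{(ℓ)})ᵀ V^{(k)}‖_F ≤ aff(S_k, S_ℓ) + (1/√(min(d_k, d_ℓ))) ‖(U^{(ℓ)})ᵀ (ΦᵀΦ − I) U^{(k)}‖_F ≤ aff(S_k, S_ℓ) + ‖(U^{(ℓ)})ᵀ (ΦᵀΦ − I) U^{(k)}‖_{2→2}. -/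
open MeasureTheory ProbabilityTheory Matrix Finset

/-- Frobenius norm of a real matrix. -/
noncomputable def frobNorm {α β : Type*} [Fintype α] [Fintype β] (A : Matrix α β ℝ) : ℝ :=
  Real.sqrt (∑ i, ∑ j, A i j ^ 2)

/-- Spectral norm (operator norm w.r.t. Euclidean norms) of a real matrix. -/
noncomputable def specNorm {α β : Type*} [Fintype α] [Fintype β] [DecidableEq β]
    (A : Matrix α β ℝ) : ℝ :=
  ‖LinearMap.toContinuousLinearMap (Matrix.toEuclideanLin A)‖

/-- A random matrix `Φ : Ω → ℝ^{p×m}` satisfies the Johnson–Lindenstrauss property with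
constant `ct > 0` if `P[ |‖Φx‖² - ‖x‖²| ≥ t‖x‖² ] ≤ 2 exp(-ct t² p)` for all `x` and `t > 0`. -/
def HasJLProperty {Ω : Type*} [MeasurableSpace Ω] (μ : Measure Ω) {p m : ℕ}
    (Φ : Ω → Matrix (Fin p) (Fin m) ℝ) (ct : ℝ) : Prop :=
  ∀ (x : Fin m → ℝ), ∀ t > (0:ℝ),
    (μ {ω | t * ∑ i, x i ^ 2 ≤ |(∑ i, ((Φ ω).mulVec x i) ^ 2) - ∑ i, x i ^ 2|}).toReal
      ≤ 2 * Real.exp (-(ct * t ^ 2 * p))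

/-- A random vector `a : Ω → ℝ^d` is uniformly distributed on the unit sphere of `ℝ^d`:
it is measurable, a.s. of unit norm, and its law is invariant under orthogonal transformations
(these properties uniquely characterize the uniform distribution on the sphere). -/
def UnifOnSphere {Ω : Type*} [MeasurableSpace Ω] (μ : Measure Ω) {d : ℕ}
    (a : Ω → Fin d → ℝ) : Prop :=
  Measurable a ∧ (∀ᵐ ω ∂μ, ∑ r, a ω r ^ 2 = 1) ∧
    ∀ R : Matrix (Fin d) (Fin d) ℝ, Rᵀ * R = 1 →
      μ.map (fun ω => R.mulVec (a ω)) = μ.map a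

/-- `U` is a matrix whose columns form an orthonormal basis of the subspace `S ⊆ ℝ^m`. -/
def IsONBasis {m d : ℕ} (U : Matrix (Fin m) (Fin d) ℝ)
    (S : Submodule ℝ (Fin m → ℝ)) : Prop :=
  Uᵀ * U = 1 ∧ S = Submodule.span ℝ (Set.range Uᵀ)

/-- The `k`-th order statistic (1-indexed, `k`-th smallest element) of a multiset of reals. -/
noncomputable def orderStat (s : Multiset ℝ) (k : ℕ) : ℝ :=
  (s.sort (· ≤ ·)).getD (k - 1) 0

section FrobeniusNorm

open scoped Matrix.Norms.Frobenius

theorem frobNorm_eq_norm {α β : Type*} [Fintype α] [Fintype β] (A : Matrix α β ℝ) :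
    frobNorm A = ‖A‖ := by
  simp [frobNorm, Matrix.frobenius_norm_def, Real.sqrt_eq_rpow]

theorem frobNorm_add_le {α β : Type*} [Fintype α] [Fintype β] (A B : Matrix α β ℝ) :
    frobNorm (A + B) ≤ frobNorm A + frobNorm B := by
  simpa only [frobNorm_eq_norm] using norm_add_le A B

theorem frobNorm_transpose {α β : Type*} [Fintype α] [Fintype β] (A : Matrix α β ℝ) :
    frobNorm Aᵀ = frobNorm A := by
  simp only [frobNorm_eq_norm, Matrix.frobenius_norm_transpose]

end FrobeniusNorm

theorem specNorm_transpose {α β : Type*} [Fintype α] [Fintype β] [DecidableEq α] [DecidableEq β]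
    (A : Matrix α β ℝ) : specNorm Aᵀ = specNorm A := by
  have h := Matrix.l2_opNorm_conjTranspose A
  rw [conjTranspose_eq_transpose_of_trivial] at h
  exact h

theorem specNorm_nonneg {α β : Type*} [Fintype α] [Fintype β] [DecidableEq β]
    (A : Matrix α β ℝ) : 0 ≤ specNorm A :=
  norm_nonneg _

theorem sum_col_sq_le_specNorm_sq {α β : Type*} [Fintype α] [Fintype β] [DecidableEq β]
    (A : Matrix α β ℝ) (j : β) : ∑ i, A i j ^ 2 ≤ specNorm A ^ 2 := by
  have h := (LinearMap.toContinuousLinearMap (Matrix.toEuclideanLin A)).le_opNorm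
    (EuclideanSpace.single j 1)
  rw [PiLp.norm_single, norm_one, mul_one] at h
  have h' := pow_le_pow_left₀ (norm_nonneg _) h 2
  simpa [specNorm, EuclideanSpace.norm_sq_eq, Matrix.toLpLin_apply] using h'

theorem frobNorm_le_sqrt_card_mul_specNorm {α β : Type*} [Fintype α] [Fintype β] [DecidableEq β]
    (A : Matrix α β ℝ) : frobNorm A ≤ √(Fintype.card β) * specNorm A := by
  refine Real.sqrt_le_iff.2 ⟨mul_nonneg (Real.sqrt_nonneg _) (specNorm_nonneg A), ?_⟩
  rw [mul_pow, Real.sq_sqrt (Nat.cast_nonneg _), Finset.sum_comm]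
  simpa using Finset.sum_le_sum fun j (_ : j ∈ Finset.univ) => sum_col_sq_le_specNorm_sq A j

theorem frobNorm_le_sqrt_min_card_mul_specNorm {α β : Type*} [Fintype α] [Fintype β]
    [DecidableEq α] [DecidableEq β] (A : Matrix α β ℝ) :
    frobNorm A ≤ √(min (Fintype.card β : ℝ) (Fintype.card α)) * specNorm A := by
  rcases min_choice (Fintype.card β : ℝ) (Fintype.card α) with h | h <;> rw [h]
  · exact frobNorm_le_sqrt_card_mul_specNorm A
  · simpa only [frobNorm_transpose, specNorm_transpose] using
      frobNorm_le_sqrt_card_mul_specNorm Aᵀ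

/-- For orthonormal bases `Uk, Ul` of subspaces `S_k, S_ℓ` and any `Φ`,
with `Vk = Φ Uk`, `Vl = Φ Ul`:
`(1/√(min(dk,dl))) ‖Vlᵀ Vk‖_F ≤ aff(S_k,S_ℓ) + (1/√(min(dk,dl))) ‖Ulᵀ(ΦᵀΦ − I)Uk‖_F
  ≤ aff(S_k,S_ℓ) + ‖Ulᵀ(ΦᵀΦ − I)Uk‖_{2→2}`. -/
theorem stmt4 {m p dk dl : ℕ}
    (Uk : Matrix (Fin m) (Fin dk) ℝ) (Ul : Matrix (Fin m) (Fin dl) ℝ)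
    (hUk : Ukᵀ * Uk = 1) (hUl : Ulᵀ * Ul = 1)
    (Φ : Matrix (Fin p) (Fin m) ℝ) :
    frobNorm ((Φ * Ul)ᵀ * (Φ * Uk)) / Real.sqrt (min (dk : ℝ) (dl : ℝ)) ≤
        frobNorm (Ukᵀ * Ul) / Real.sqrt (min (dk : ℝ) (dl : ℝ)) +
          frobNorm (Ulᵀ * (Φᵀ * Φ - 1) * Uk) / Real.sqrt (min (dk : ℝ) (dl : ℝ)) ∧
      frobNorm (Ukᵀ * Ul) / Real.sqrt (min (dk : ℝ) (dl : ℝ)) +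
          frobNorm (Ulᵀ * (Φᵀ * Φ - 1) * Uk) / Real.sqrt (min (dk : ℝ) (dl : ℝ)) ≤
        frobNorm (Ukᵀ * Ul) / Real.sqrt (min (dk : ℝ) (dl : ℝ)) +
          specNorm (Ulᵀ * (Φᵀ * Φ - 1) * Uk) := by
  refine ⟨?_, ?_⟩
  · rw [← add_div]
    refine div_le_div_of_nonneg_right ?_ (Real.sqrt_nonneg _)
    have h : (Φ * Ul)ᵀ * (Φ * Uk) = (Ukᵀ * Ul)ᵀ + Ulᵀ * (Φᵀ * Φ - 1) * Uk := by
      simp only [transpose_mul, transpose_transpose, Matrix.mul_sub, Matrix.sub_mul,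
        Matrix.mul_one, Matrix.mul_assoc]
      abel
    rw [h, ← frobNorm_transpose (Ukᵀ * Ul)]
    exact frobNorm_add_le _ _
  · gcongr
    refine div_le_of_le_mul₀ (Real.sqrt_nonneg _) (specNorm_nonneg _) ?_
    rw [mul_comm]
    have h := frobNorm_le_sqrt_min_card_mul_specNorm (Ulᵀ * (Φᵀ * Φ - 1) * Uk)
    rw [Fintype.card_fin, Fintype.card_fin] at h
    exact h
end

section
/- Consider points x_j^{(k)}, y-values z̃_j^{(k)} ≥ 0 and z_j^{(k)} ≥ 0 indexed by k ∈ [L], j ∈ [n_k], a fixed pair (i, ℓ) with n_ℓ − 1 ≥ q, and real numbers α, ε ≥ 0 and d_ℓ ≥ 1 with α + 2ε ≤ 2/(3√(d_ℓ)). Suppose that |z_j^{(k)} − z̃_j^{(k)}| ≤ ε for all (j, k) ≠ (i, ℓ), that the (n_ℓ − q)-th order statistic z̃_{(n_ℓ−q)}^{(ℓ)} of {z̃_j^{(ℓ)} : j ∈ [n_ℓ] \ {i}} satisfies z̃_{(n_ℓ−q)}^{(ℓ)} > 2/(3√(d_ℓ)), and that max_{k ∈ [L]\{ℓ}, j ∈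 [n_k]} z̃_j^{(k)} < α. Then z_{(n_ℓ−q)}^{(ℓ)} > max_{k ∈ [L]\{ℓ}, j ∈ [n_k]} z_j^{(k)}, where z_{(n_ℓ−q)}^{(ℓ)} is the (n_ℓ−q)-th order statistic of {z_j^{(ℓ)} : j ∈ [n_ℓ] \ {i}}. -/
open MeasureTheory ProbabilityTheory Matrix Finset

/-- In a sorted list, the entry at index `m` exceeds `t` iff at most `m` entries are `≤ t`. -/
theorem lt_getElem_iff_countP_le {t : ℝ} : ∀ {l : List ℝ}, l.Pairwise (· ≤ ·) →
    ∀ {m : ℕ} (hm : m < l.length), t < l[m] ↔ l.countP (fun x => decide (x ≤ t)) ≤ m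
  | [], _, m, hm => absurd hm (Nat.not_lt_zero m)
  | a :: l, hl, m, hm => by
    obtain ⟨ha, hl⟩ := List.pairwise_cons.1 hl
    rcases lt_or_ge t a with h | h
    · have h0 : (a :: l).countP (fun x => decide (x ≤ t)) = 0 := by
        rw [List.countP_eq_zero]
        intro x hx
        rcases List.mem_cons.1 hx with rfl | hx
        · simpa using h
        · simpa using h.trans_le (ha x hx)
      have hmem := List.getElem_mem hm
      rw [h0]
      refine iff_of_true ?_ (Nat.zero_le m)
      rcases List.mem_cons.1 hmem with h' | h'
      · rwa [h']
      · exact h.trans_le (ha _ h')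
    · rw [List.countP_cons_of_pos (by simpa using h)]
      cases m with
      | zero => simpa using h
      | succ m =>
        simpa using lt_getElem_iff_countP_le hl (m := m) (by simpa using hm)

theorem lt_orderStat_iff {s : Multiset ℝ} {k : ℕ} {t : ℝ} (hk : 1 ≤ k) (hks : k ≤ s.card) :
    t < orderStat s k ↔ s.countP (· ≤ t) < k := by
  have hlen : k - 1 < (s.sort (· ≤ ·)).length := by
    rw [Multiset.length_sort]
    omega
  have hcount : s.countP (· ≤ t) =
      (s.sort (· ≤ ·)).countP (fun x => decide (x ≤ t)) := by
    conv_lhs => rw [← Multiset.sort_eq s (· ≤ ·)]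
    exact Multiset.coe_countP _ _
  rw [orderStat, List.getD_eq_getElem _ _ hlen,
    lt_getElem_iff_countP_le (Multiset.pairwise_sort s (· ≤ ·)) hlen, hcount]
  omega

/-- Lowering each value by at most `ε` lowers an order statistic by at most `ε`. -/
theorem sub_lt_orderStat_map {ι : Type*} {s : Finset ι} {f g : ι → ℝ} {k : ℕ} {t ε : ℝ}
    (hk : 1 ≤ k) (hks : k ≤ s.card) (hfg : ∀ j ∈ s, f j - ε ≤ g j)
    (ht : t < orderStat (s.val.map f) k) : t - ε < orderStat (s.val.map g) k := by
  rw [lt_orderStat_iff hk (by simpa using hks)] at ht ⊢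
  refine lt_of_le_of_lt ?_ ht
  rw [Multiset.countP_map, Multiset.countP_map]
  change (s.filter fun j => g j ≤ t - ε).card ≤ (s.filter fun j => f j ≤ t).card
  refine Finset.card_le_card fun j hj => ?_
  rw [Finset.mem_filter] at hj ⊢
  exact ⟨hj.1, by linarith [hfg j hj.1, hj.2]⟩

/-- Deterministic perturbation lemma from the proof of the TSC theorem.
If the out-of-cluster values `z̃` are `< α`, the `(n_ℓ − q)`-th in-cluster order statistic of
`z̃` is `> 2/(3√d_ℓ)`, `|z − z̃| ≤ ε` off `(i, ℓ)`, and `α + 2ε ≤ 2/(3√d_ℓ)`, then the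
`(n_ℓ − q)`-th in-cluster order statistic of `z` strictly exceeds all out-of-cluster `z`. -/
theorem stmt13 {L : ℕ} (n : Fin L → ℕ)
    (zt z : (Σ k : Fin L, Fin (n k)) → ℝ)
    (hzt : ∀ i, 0 ≤ zt i) (hz : ∀ i, 0 ≤ z i)
    (ℓ : Fin L) (i : Fin (n ℓ)) (q : ℕ) (hq1 : 1 ≤ q) (hq : q + 1 ≤ n ℓ)
    (α ε dl : ℝ) (hα : 0 ≤ α) (hε : 0 ≤ ε) (hdl : 1 ≤ dl)
    (hαε : α + 2 * ε ≤ 2 / (3 * Real.sqrt dl))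
    (hclose : ∀ jk : Σ k : Fin L, Fin (n k), jk ≠ ⟨ℓ, i⟩ → |z jk - zt jk| ≤ ε)
    (hord : 2 / (3 * Real.sqrt dl) <
      orderStat ((Finset.univ.erase i).val.map fun j => zt ⟨ℓ, j⟩) (n ℓ - q))
    (hmax : ∀ k : Fin L, k ≠ ℓ → ∀ j : Fin (n k), zt ⟨k, j⟩ < α) :
    ∀ k : Fin L, k ≠ ℓ → ∀ j : Fin (n k),
      z ⟨k, j⟩ <
        orderStat ((Finset.univ.erase i).val.map fun j => z ⟨ℓ, j⟩) (n ℓ - q) := by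
  intro k hk j
  have hin : ∀ j ∈ Finset.univ.erase i, zt ⟨ℓ, j⟩ - ε ≤ z ⟨ℓ, j⟩ := by
    intro j hj
    have hne : (⟨ℓ, j⟩ : Σ k : Fin L, Fin (n k)) ≠ ⟨ℓ, i⟩ := by
      simpa using Finset.ne_of_mem_erase hj
    linarith [(abs_le.1 (hclose _ hne)).1]
  have hout : (⟨k, j⟩ : Σ k : Fin L, Fin (n k)) ≠ ⟨ℓ, i⟩ :=
    fun h => hk (congrArg Sigma.fst h)
  have hcard : n ℓ - q ≤ (Finset.univ.erase i).card := by
    rw [Finset.card_erase_of_mem (Finset.mem_univ i), Finset.card_univ, Fintype.card_fin]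
    omega
  linarith [(abs_le.1 (hclose _ hout)).2, hmax k hk j,
    sub_lt_orderStat_map (by omega) hcard hin hord]
end
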